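/- Theorem 4 (regime Ip = ω(log Λ), explicit sequence form). Fix γ ∈ (0,1) and consider a sequence of systems indexed by n: Λ_n → ∞ with t_n = γΛ_n an integer, integers I_n ≥ 1, probabilities p_n ∈ (0, 1/2], K_n = I_n Λ_n users each active independently with probability p_n, and the uniform association g_n assigning I_n users to each of the Λ_n caches. If I_n p_n / log Λ_n → ∞, then there exist constants 0 < c₁ ≤ c₂ and N such that for all n ≥ N: c₁ · K_n p_n (1−γ)/(1+t_n) ≤ T̄(g_n) ≤ c₂ · K_n p_n (1−γ)/(1+t_n). -/

import Mathlib

open Finset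

noncomputable section

/-- Probability weight of an activity pattern `ω` under independent Bernoulli
activities with success probabilities `p`. -/
def wgt {K : ℕ} (p : Fin K → ℝ) (ω : Fin K → Bool) : ℝ :=
  ∏ k, if ω k then p k else 1 - p k

/-- Load of cache `c` under association `g` and activity pattern `ω`:
the number of active users assigned to cache `c`. -/
def load {K Λ : ℕ} (g : Fin K → Fin Λ) (ω : Fin K → Bool) (c : Fin Λ) : ℕ :=
  ∑ k, if g k = c ∧ ω k = true then 1 else 0

/-- Decreasing rearrangement of a tuple of naturals, indexed by `ℕ`
(value `0` out of range): `sortDescN v 0` is the largest entry,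
`sortDescN v (Λ-1)` the smallest. -/
def sortDescN {Λ : ℕ} (v : Fin Λ → ℕ) (i : ℕ) : ℕ :=
  if h : i < Λ then (v ∘ Tuple.sort v) (Fin.rev ⟨i, h⟩) else 0

/-- Expectation of a real-valued functional of the activity pattern. -/
def expec {K : ℕ} (p : Fin K → ℝ) (f : (Fin K → Bool) → ℝ) : ℝ :=
  ∑ ω : Fin K → Bool, wgt p ω * f ω

/-- Average worst-case delay of association `g`:
`T̄(g) = ∑_{λ=1}^{Λ-t} E[l_λ] C(Λ-λ,t)/C(Λ,t)` (here `i = λ - 1` is 0-based). -/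
def avgDelay {K Λ : ℕ} (p : Fin K → ℝ) (g : Fin K → Fin Λ) (t : ℕ) : ℝ :=
  ∑ i ∈ Finset.range (Λ - t),
    expec p (fun ω => (sortDescN (load g ω) i : ℝ)) * ((Λ - 1 - i).choose t : ℝ) /
      (Λ.choose t : ℝ)

/-- `μ_λ`: expected number of active users assigned to cache `c`. -/
def muC {K Λ : ℕ} (p : Fin K → ℝ) (g : Fin K → Fin Λ) (c : Fin Λ) : ℝ :=
  ∑ k, if g k = c then p k else 0

/-- `σ_λ²`: variance of the number of active users assigned to cache `c`. -/
def sigma2C {K Λ : ℕ} (p : Fin K → ℝ) (g : Fin K → Fin Λ) (c : Fin Λ) : ℝ :=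
  ∑ k, if g k = c then p k * (1 - p k) else 0

/-- `|G_λ|`: the number of users assigned to cache `c`. -/
def Gcard {K Λ : ℕ} (g : Fin K → Fin Λ) (c : Fin Λ) : ℕ :=
  (Finset.univ.filter fun k => g k = c).card

/-- Binomial cumulative distribution function `F_bin(n,q,x)`. -/
def Fbin (n : ℕ) (q : ℝ) (x : ℕ) : ℝ :=
  ∑ i ∈ Finset.range (x + 1), (n.choose i : ℝ) * q ^ i * (1 - q) ^ (n - i)

theorem expec_prod {K : ℕ} (p : Fin K → ℝ) (f : Fin K → Bool → ℝ) :
    expec p (fun ω => ∏ k, f k (ω k)) = ∏ k, (p k * f k true + (1 - p k) * f k false) := by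
  have h := Finset.prod_univ_sum (fun _ : Fin K => (Finset.univ : Finset Bool))
    (fun k b => (if b then p k else 1 - p k) * f k b)
  simp only [Fintype.sum_bool, Fintype.piFinset_univ] at h
  simp only [expec, wgt, ← Finset.prod_mul_distrib]
  simpa using h.symm

theorem expec_sum {K : ℕ} {ι : Type*} (s : Finset ι) (p : Fin K → ℝ)
    (f : ι → (Fin K → Bool) → ℝ) :
    expec p (fun ω => ∑ i ∈ s, f i ω) = ∑ i ∈ s, expec p (f i) := by
  simp only [expec, Finset.mul_sum]
  exact Finset.sum_comm

theorem expec_mul_const {K : ℕ} (p : Fin K → ℝ) (f : (Fin K → Bool) → ℝ) (a : ℝ) :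
    expec p (fun ω => f ω * a) = expec p f * a := by
  simp only [expec, Finset.sum_mul, mul_assoc]

theorem expec_const {K : ℕ} (p : Fin K → ℝ) (a : ℝ) : expec p (fun _ => a) = a := by
  have h := expec_prod p (fun _ _ => 1)
  have h' := expec_mul_const p (fun _ => 1) a
  simp only [Finset.prod_const_one, mul_one, add_sub_cancel, one_mul] at h h'
  rw [h', h, one_mul]

theorem expec_add {K : ℕ} (p : Fin K → ℝ) (f f' : (Fin K → Bool) → ℝ) :
    expec p (fun ω => f ω + f' ω) = expec p f + expec p f' := by
  simp only [expec, mul_add, Finset.sum_add_distrib]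

theorem expec_mono {K : ℕ} {p : Fin K → ℝ} (hp0 : ∀ k, 0 ≤ p k) (hp1 : ∀ k, p k ≤ 1)
    {f f' : (Fin K → Bool) → ℝ} (h : ∀ ω, f ω ≤ f' ω) : expec p f ≤ expec p f' := by
  refine Finset.sum_le_sum fun ω _ => mul_le_mul_of_nonneg_left (h ω) ?_
  refine Finset.prod_nonneg fun k _ => ?_
  split_ifs
  · exact hp0 k
  · exact sub_nonneg.2 (hp1 k)

theorem expec_indicator {K : ℕ} (p : Fin K → ℝ) (k : Fin K) :
    expec p (fun ω => if ω k = true then 1 else 0) = p k := by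
  have h := expec_prod p (fun j b => if j = k then (if b = true then 1 else 0) else 1)
  have hf : (fun ω : Fin K → Bool =>
      ∏ j, if j = k then (if ω j = true then (1 : ℝ) else 0) else 1) =
      fun ω => if ω k = true then 1 else 0 := by
    ext ω
    simp
  rw [hf] at h
  rw [h, Finset.prod_eq_single k]
  · simp
  · intro j _ hj
    simp [hj]
  · simp

theorem sum_load {K Λ : ℕ} (g : Fin K → Fin Λ) (ω : Fin K → Bool) :
    ∑ c, load g ω c = ∑ k, if ω k = true then 1 else 0 := by
  simp only [load]
  rw [Finset.sum_comm]
  refine Finset.sum_congr rfl fun k _ => ?_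
  simp [ite_and]

theorem expec_exp_load_le {K Λ : ℕ} {p : ℝ} (hp0 : 0 ≤ p)
    (g : Fin K → Fin Λ) (c : Fin Λ) :
    expec (fun _ => p) (fun ω => Real.exp (load g ω c)) ≤
      Real.exp (Gcard g c * (p * (Real.exp 1 - 1))) := by
  have h := expec_prod (fun _ : Fin K => p)
    (fun k b => Real.exp (if g k = c ∧ b = true then 1 else 0))
  have hf : (fun ω : Fin K → Bool => Real.exp (load g ω c)) =
      fun ω => ∏ k, Real.exp (if g k = c ∧ ω k = true then 1 else 0) := by
    ext ω
    rw [← Real.exp_sum]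
    simp [load]
  have hexp : (Gcard g c * (p * (Real.exp 1 - 1)) : ℝ) =
      ∑ k, if g k = c then p * (Real.exp 1 - 1) else 0 := by
    rw [← Finset.sum_filter, Finset.sum_const, nsmul_eq_mul, Gcard]
  rw [hf, h, hexp, Real.exp_sum]
  have he : 0 ≤ p * (Real.exp 1 - 1) :=
    mul_nonneg hp0 (sub_nonneg.2 (Real.one_le_exp zero_le_one))
  refine Finset.prod_le_prod (fun k _ => ?_) fun k _ => ?_
  · by_cases hk : g k = c
    · simp only [hk, true_and, if_true, Bool.false_eq_true, if_false, Real.exp_zero]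
      linarith
    · simp [hk]
  · by_cases hk : g k = c
    · have := Real.add_one_le_exp (p * (Real.exp 1 - 1))
      simp only [hk, true_and, if_true, Bool.false_eq_true, if_false, Real.exp_zero]
      linarith
    · simp [hk]

theorem sortDescN_coe {Λ : ℕ} (v : Fin Λ → ℕ) (i : Fin Λ) :
    sortDescN v i = v (Tuple.sort v (Fin.rev i)) := by
  simp [sortDescN]

theorem antitone_sortDescN {Λ : ℕ} (v : Fin Λ → ℕ) :
    Antitone fun i : Fin Λ => sortDescN v i := by
  intro i j hij
  simp only [sortDescN_coe]
  exact Tuple.monotone_sort v (Fin.rev_le_rev.2 hij)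

theorem sum_sortDescN {Λ : ℕ} (v : Fin Λ → ℕ) :
    ∑ i : Fin Λ, sortDescN v i = ∑ c, v c := by
  simp only [sortDescN_coe]
  exact Equiv.sum_comp (Fin.revPerm.trans (Tuple.sort v)) v

theorem sum_choose_reflect (Λ t : ℕ) :
    ∑ i ∈ Finset.range Λ, (Λ - 1 - i).choose t = Λ.choose (t + 1) := by
  rw [Finset.sum_range_reflect (fun m => m.choose t) Λ]
  induction Λ with
  | zero => simp
  | succ m ih => rw [Finset.sum_range_succ, ih, Nat.choose_succ_succ, add_comm]

theorem sum_choose_div_choose {Λ t : ℕ} (h : t ≤ Λ) :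
    ∑ i : Fin Λ, ((Λ - 1 - i).choose t : ℝ) / (Λ.choose t : ℝ) =
      ((Λ : ℝ) - t) / (1 + t) := by
  have h1 := Fin.sum_univ_eq_sum_range (fun i => (Λ - 1 - i).choose t) Λ
  rw [sum_choose_reflect] at h1
  have h2 : (Λ.choose (t + 1) : ℝ) * (t + 1) = Λ.choose t * ((Λ : ℝ) - t) := by
    rw [← Nat.cast_sub h]
    exact_mod_cast Nat.choose_succ_right_eq Λ t
  have h3 : (0 : ℝ) < Λ.choose t := by exact_mod_cast Nat.choose_pos h
  have h4 : (0 : ℝ) < 1 + t := by positivity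
  rw [← Finset.sum_div, ← Nat.cast_sum, h1, div_eq_div_iff h3.ne' h4.ne']
  linarith

theorem avgDelay_eq_sum_fin {K Λ : ℕ} (p : Fin K → ℝ) (g : Fin K → Fin Λ) (t : ℕ) :
    avgDelay p g t = ∑ i : Fin Λ, expec p (fun ω => (sortDescN (load g ω) i : ℝ)) *
      (((Λ - 1 - i).choose t : ℝ) / (Λ.choose t : ℝ)) := by
  rw [Fin.sum_univ_eq_sum_range (fun i => expec p (fun ω => (sortDescN (load g ω) i : ℝ)) *
      (((Λ - 1 - i).choose t : ℝ) / (Λ.choose t : ℝ))) Λ]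
  simp only [avgDelay, mul_div_assoc]
  refine Finset.sum_subset (Finset.range_subset_range.2 (Nat.sub_le Λ t)) fun i hi hi' => ?_
  rw [Finset.mem_range] at hi hi'
  rw [Nat.choose_eq_zero_of_lt (by omega)]
  simp

theorem sum_mul_sum_le_card_mul_avgDelay {K Λ : ℕ} {p : Fin K → ℝ} (hp0 : ∀ k, 0 ≤ p k)
    (hp1 : ∀ k, p k ≤ 1) (g : Fin K → Fin Λ) (t : ℕ) :
    (∑ k, p k) * ∑ i : Fin Λ, ((Λ - 1 - i).choose t : ℝ) / (Λ.choose t : ℝ) ≤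
      Λ * avgDelay p g t := by
  have hant : ∀ ω, Antitone fun i : Fin Λ => (sortDescN (load g ω) i : ℝ) := fun ω i j hij =>
    Nat.cast_le.2 (antitone_sortDescN _ hij)
  have hw : Antitone fun i : Fin Λ => ((Λ - 1 - i).choose t : ℝ) / (Λ.choose t : ℝ) := by
    intro i j hij
    have : (i : ℕ) ≤ j := hij
    refine div_le_div_of_nonneg_right (Nat.cast_le.2 (Nat.choose_le_choose t ?_))
      (Nat.cast_nonneg _)
    omega
  have hE : expec p (fun ω => ∑ i : Fin Λ, (sortDescN (load g ω) i : ℝ)) = ∑ k, p k := by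
    simp_rw [← expec_indicator p]
    rw [← expec_sum]
    congr 1
    ext ω
    rw [← Nat.cast_sum, sum_sortDescN, sum_load]
    push_cast
    rfl
  have hA : avgDelay p g t * Λ = expec p (fun ω => (∑ i : Fin Λ, (sortDescN (load g ω) i : ℝ) *
      (((Λ - 1 - i).choose t : ℝ) / (Λ.choose t : ℝ))) * Λ) := by
    rw [expec_mul_const, expec_sum, avgDelay_eq_sum_fin]
    simp only [expec_mul_const]
  rw [mul_comm (Λ : ℝ), hA, ← hE, ← expec_mul_const]
  refine expec_mono hp0 hp1 fun ω => ?_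
  have := ((hant ω).monovary hw).sum_mul_sum_le_card_mul_sum
  simpa [mul_comm] using this

theorem expec_sortDescN_load_le {K Λ : ℕ} {p : ℝ} {m : ℕ} (hp0 : 0 ≤ p) (hp1 : p ≤ 1)
    (g : Fin K → Fin Λ) (hg : ∀ c, Gcard g c = m) (i : Fin Λ) :
    expec (fun _ => p) (fun ω => (sortDescN (load g ω) i : ℝ)) ≤
      Real.log Λ + m * (p * (Real.exp 1 - 1)) := by
  set a : ℝ := Real.log Λ + m * (p * (Real.exp 1 - 1)) with ha
  have hΛ : (0 : ℝ) < Λ := by exact_mod_cast i.pos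
  have hle : ∀ ω, (sortDescN (load g ω) i : ℝ) ≤
      (a - 1) + (∑ c, Real.exp (load g ω c)) * Real.exp (-a) := by
    intro ω
    rw [sortDescN_coe]
    set c := Tuple.sort (load g ω) (Fin.rev i)
    have h1 := Finset.single_le_sum (f := fun c => Real.exp (load g ω c))
      (fun c _ => (Real.exp_pos _).le) (Finset.mem_univ c)
    have h2 := Real.add_one_le_exp ((load g ω c : ℝ) + -a)
    rw [Real.exp_add] at h2
    have h3 := mul_le_mul_of_nonneg_right h1 (Real.exp_pos (-a)).le
    linarith
  have hsum : ∑ c, expec (fun _ => p) (fun ω => Real.exp (load g ω c)) ≤ Real.exp a := by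
    calc _ ≤ ∑ _c : Fin Λ, Real.exp (m * (p * (Real.exp 1 - 1))) :=
          Finset.sum_le_sum fun c _ => hg c ▸ expec_exp_load_le hp0 g c
      _ = Real.exp a := by
          rw [ha, Real.exp_add, Real.exp_log hΛ]
          simp
  calc _ ≤ _ := expec_mono (fun _ => hp0) (fun _ => hp1) hle
    _ = (a - 1) + (∑ c, expec (fun _ => p) (fun ω => Real.exp (load g ω c))) * Real.exp (-a) := by
        rw [expec_add, expec_const, expec_mul_const, expec_sum]
    _ ≤ (a - 1) + Real.exp a * Real.exp (-a) := by gcongr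
    _ = a := by rw [← Real.exp_add]; simp

/-- Theorem 4 (regime `I_n p_n = ω(log Λ_n)`, explicit sequence form): for a sequence
of systems with `Λ_n → ∞`, `t_n = γΛ_n`, `K_n = I_n Λ_n` users of activity level
`p_n ∈ (0,1/2]` and uniform associations `g_n`, if `I_n p_n / log Λ_n → ∞` then
`T̄(g_n) = Θ(K_n p_n (1-γ)/(1+t_n))`. -/
theorem theorem4_first_regime (γ : ℝ) (hγ0 : 0 < γ) (hγ1 : γ < 1)
    (Λ I t : ℕ → ℕ) (p : ℕ → ℝ)
    (hΛ : Filter.Tendsto Λ Filter.atTop Filter.atTop)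
    (ht : ∀ n, (t n : ℝ) = γ * (Λ n : ℝ))
    (hI : ∀ n, 1 ≤ I n)
    (hp : ∀ n, 0 < p n ∧ p n ≤ 1 / 2)
    (g : (n : ℕ) → Fin (I n * Λ n) → Fin (Λ n))
    (hg : ∀ n, ∀ c : Fin (Λ n), Gcard (g n) c = I n)
    (hreg : Filter.Tendsto (fun n => (I n : ℝ) * p n / Real.log (Λ n))
      Filter.atTop Filter.atTop) :
    ∃ c₁ c₂ : ℝ, ∃ N : ℕ, 0 < c₁ ∧ c₁ ≤ c₂ ∧
      ∀ n, N ≤ n →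
        c₁ * (((I n * Λ n : ℕ) : ℝ) * p n * (1 - γ) / (1 + (t n : ℝ))) ≤
            avgDelay (fun _ => p n) (g n) (t n) ∧
          avgDelay (fun _ => p n) (g n) (t n) ≤
            c₂ * (((I n * Λ n : ℕ) : ℝ) * p n * (1 - γ) / (1 + (t n : ℝ))) := by
  refine ⟨1, Real.exp 1, ?_⟩
  obtain ⟨N, hN⟩ := Filter.eventually_atTop.1
    ((hreg.eventually_ge_atTop 1).and (hΛ.eventually_ge_atTop 2))
  refine ⟨N, one_pos, Real.one_le_exp zero_le_one, fun n hn => ?_⟩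
  obtain ⟨hlog, hΛ2⟩ := hN n hn
  have hΛ2' : (2 : ℝ) ≤ Λ n := by exact_mod_cast hΛ2
  have hΛ0 : (0 : ℝ) < Λ n := by linarith
  rw [le_div_iff₀ (Real.log_pos (by linarith)), one_mul] at hlog
  obtain ⟨hp0, hp2⟩ := hp n
  have hp1 : p n ≤ 1 := by linarith
  have htΛ : t n ≤ Λ n := by
    have : (t n : ℝ) ≤ Λ n := by rw [ht n]; nlinarith
    exact_mod_cast this
  have hS := sum_choose_div_choose htΛ
  have hrate : ((I n * Λ n : ℕ) : ℝ) * p n * (1 - γ) / (1 + (t n : ℝ)) =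
      I n * p n * (((Λ n : ℝ) - t n) / (1 + t n)) := by
    rw [ht n]
    push_cast
    ring
  rw [hrate, ← hS]
  constructor
  · have h := sum_mul_sum_le_card_mul_avgDelay (fun _ => hp0.le) (fun _ => hp1) (g n) (t n)
    rw [Finset.sum_const, Finset.card_univ, Fintype.card_fin, nsmul_eq_mul] at h
    push_cast at h
    refine le_of_mul_le_mul_left ?_ hΛ0
    linarith
  · rw [avgDelay_eq_sum_fin, ← mul_assoc, Finset.mul_sum]
    refine Finset.sum_le_sum fun i _ => mul_le_mul_of_nonneg_right ?_ (by positivity)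
    have h := expec_sortDescN_load_le hp0.le hp1 (g n) (hg n) i
    linarith

end
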